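/- Let 0 < α ≤ 1 and a > 0. Then no a-orbit of the mini-boson-star system with parameters a and α defined for all x ≥ 0 is globally regular; i.e., there is no solution defined on [0, ∞) with f(0) = a > 0, A(0) = 1, C(0) = α ≤ 1 for which lim_{x→∞} M(x) exists and is finite. -/

import Mathlib

open Real Set Filter Topology MeasureTheory

noncomputable section

/-- The mini-boson-star ODE system for `f, A, C` on a set `s ⊆ (0, ∞)`
(prime denotes `d/dx`):
`(x² f'/C)' = (x²/(A C))·(1 − A C²)·f`,
`A' = (1 − A)/x − x·(A f'² + A C² f² + f²)`,
`C' = (C/(x A))·(A − 1 + x² f²)`, with `A > 0` and `C > 0`. -/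
def MiniBosonSystem (f A C : ℝ → ℝ) (s : Set ℝ) : Prop :=
  ∀ x ∈ s, 0 < x ∧ 0 < A x ∧ 0 < C x ∧
    DifferentiableAt ℝ f x ∧ DifferentiableAt ℝ (deriv f) x ∧
    DifferentiableAt ℝ A x ∧ DifferentiableAt ℝ C x ∧
    deriv (fun y => y ^ 2 * deriv f y / C y) x
      = x ^ 2 / (A x * C x) * (1 - A x * C x ^ 2) * f x ∧
    deriv A x = (1 - A x) / x
      - x * (A x * deriv f x ^ 2 + A x * C x ^ 2 * f x ^ 2 + f x ^ 2) ∧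
    deriv C x = C x / (x * A x) * (A x - 1 + x ^ 2 * f x ^ 2)

/-- A domain of the form `[0, x̄)` with `0 < x̄ ≤ ∞`. -/
def IsOrbitDomain (s : Set ℝ) : Prop :=
  s = Set.Ici (0 : ℝ) ∨ ∃ xbar > (0 : ℝ), s = Set.Ico 0 xbar

/-- An `a`-orbit of the mini-boson-star system with parameters `a, α` on the
domain `s = [0, x̄)`: a solution of the system on `s \ {0}`, continuous up to
`x = 0` with `f` differentiable at `0`, satisfying `f 0 = a`, `f' 0 = 0`,
`A 0 = 1`, `C 0 = α`. -/
def IsAOrbit (f A C : ℝ → ℝ) (a α : ℝ) (s : Set ℝ) : Prop :=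
  IsOrbitDomain s ∧
  MiniBosonSystem f A C (s \ {0}) ∧
  ContinuousWithinAt f s 0 ∧ ContinuousWithinAt A s 0 ∧ ContinuousWithinAt C s 0 ∧
  HasDerivWithinAt f 0 s 0 ∧
  f 0 = a ∧ A 0 = 1 ∧ C 0 = α

/-- The mass function `M(x) = x (1 − A x)/2`. -/
def massFn (A : ℝ → ℝ) (x : ℝ) : ℝ := x * (1 - A x) / 2

/-- `θ` is the rotation function of the orbit with scalar field `f`:
`θ` is continuous on the domain, `θ 0 = 0`, and for every `x` in the domain
there is `ρ x > 0` with `f x = ρ x · cos (θ x)` and `f' x = −ρ x · sin (θ x)`. -/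
def IsRotation (f θ : ℝ → ℝ) (s : Set ℝ) : Prop :=
  ContinuousOn θ s ∧ θ 0 = 0 ∧
  ∀ x ∈ s, ∃ ρ > (0 : ℝ), f x = ρ * Real.cos (θ x) ∧ deriv f x = -(ρ * Real.sin (θ x))

/-- On `[0, ∞)`, a function that is continuous up to `0` and nonincreasing wherever it exceeds `b`
never exceeds `b` if it starts below `b`. -/
theorem le_of_hasDerivAt_nonpos_of_gt {h h' : ℝ → ℝ} {b : ℝ} (hc : ContinuousOn h (Ici 0))
    (hd : ∀ x, 0 < x → HasDerivAt h (h' x) x) (h0 : h 0 ≤ b)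
    (hneg : ∀ x, 0 < x → b < h x → h' x ≤ 0) {x : ℝ} (hx : 0 ≤ x) : h x ≤ b := by
  by_contra! hbx
  have hcx : ContinuousOn h (Icc 0 x) := hc.mono Icc_subset_Ici_self
  have hcomp : IsCompact (Icc 0 x ∩ h ⁻¹' Iic b) :=
    isCompact_Icc.of_isClosed_subset (hcx.preimage_isClosed_of_isClosed isClosed_Icc isClosed_Iic)
      inter_subset_left
  obtain ⟨y, ⟨⟨hy0, hyx⟩, hyb⟩, hmax⟩ := hcomp.exists_isGreatest ⟨0, ⟨le_rfl, hx⟩, h0⟩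
  have hanti : AntitoneOn h (Icc y x) := by
    apply antitoneOn_of_hasDerivWithinAt_nonpos (convex_Icc y x)
      (hcx.mono (Icc_subset_Icc_left hy0)) (f' := h')
    · intro z hz
      rw [interior_Icc] at hz
      exact (hd z (hy0.trans_lt hz.1)).hasDerivWithinAt
    · intro z hz
      rw [interior_Icc] at hz
      refine hneg z (hy0.trans_lt hz.1) ?_
      by_contra! hzb
      exact (hmax ⟨⟨hy0.trans hz.1.le, hz.2.le⟩, hzb⟩).not_gt hz.1
  have hle : h x ≤ h y := hanti (left_mem_Icc.2 hyx) (right_mem_Icc.2 hyx) hyx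
  exact absurd (hle.trans hyb) hbx.not_ge

/-- If `u' = p C / x²` with `p` nondecreasing and `C` bounded below near `0`, and `u` has vanishing
derivative at `0`, then `p` is nonnegative. -/
theorem nonneg_of_monotoneOn_of_hasDerivWithinAt_zero {u p C : ℝ → ℝ} {c : ℝ} (hc : 0 < c)
    (hC : ∀ᶠ x in 𝓝[≥] 0, c ≤ C x) (hp : MonotoneOn p (Ioi 0))
    (hu : ∀ x, 0 < x → HasDerivAt u (p x * C x / x ^ 2) x)
    (hu0 : HasDerivWithinAt u 0 (Ici 0) 0) {x : ℝ} (hx : 0 < x) : 0 ≤ p x := by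
  by_contra! hneg
  obtain ⟨δ, hδ, hCδ⟩ := mem_nhdsGE_iff_exists_Ico_subset.1 hC
  have hk : 0 < -p x * c := mul_pos (neg_pos.2 hneg) hc
  have hlim : Tendsto (slope u 0) (𝓝[>] 0) (𝓝 0) := by
    have := hasDerivWithinAt_iff_tendsto_slope.1 hu0
    rwa [Ici_sdiff_left] at this
  have hbig : ∀ᶠ y in 𝓝[>] (0 : ℝ), -(-p x * c) < slope u 0 y :=
    hlim.eventually_const_lt (neg_lt_zero.2 hk)
  have hsmall : ∀ᶠ y in 𝓝[>] (0 : ℝ), y ∈ Ioo 0 (min (min δ x) 1) :=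
    Ioo_mem_nhdsGT (lt_min (lt_min hδ hx) one_pos)
  obtain ⟨y, hyb, hy0, hy⟩ := (hbig.and hsmall).exists
  obtain ⟨hy', hy1⟩ := lt_min_iff.1 hy
  obtain ⟨hyδ, hyx⟩ := lt_min_iff.1 hy'
  obtain ⟨z, ⟨hz0, hzy⟩, hz⟩ := exists_hasDerivAt_eq_slope u (fun x => p x * C x / x ^ 2) hy0
    (fun t ht => by
      rcases ht.1.eq_or_lt with rfl | ht0
      · exact hu0.continuousWithinAt.mono Icc_subset_Ici_self
      · exact (hu t ht0).continuousAt.continuousWithinAt)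
    (fun t ht => hu t ht.1)
  rw [slope_def_field, ← hz, lt_div_iff₀ (by positivity)] at hyb
  have hpz : p z ≤ p x := hp hz0 hx (hzy.trans hyx).le
  have hCz : c ≤ C z := hCδ ⟨hz0.le, hzy.trans hyδ⟩
  have hz2 : z ^ 2 ≤ 1 := pow_le_one₀ hz0.le (hzy.trans hy1).le
  have h1 : -p x * c ≤ -p z * C z :=
    mul_le_mul (neg_le_neg hpz) hCz hc.le (by linarith)
  nlinarith

section Orbit

variable {f A C : ℝ → ℝ} {a α : ℝ}

theorem MiniBosonSystem.hasDerivAt_massFn (h : MiniBosonSystem f A C (Ioi 0)) {x : ℝ}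
    (hx : 0 < x) :
    HasDerivAt (massFn A)
      (x ^ 2 / 2 * (A x * deriv f x ^ 2 + A x * C x ^ 2 * f x ^ 2 + f x ^ 2)) x := by
  obtain ⟨-, -, -, -, -, hdA, -, -, hA', -⟩ := h x hx
  have := ((hasDerivAt_id x).mul (hdA.hasDerivAt.const_sub 1)).div_const 2
  refine this.congr_deriv ?_
  rw [hA']
  simp only [id]
  field_simp
  ring

theorem MiniBosonSystem.hasDerivAt_mul_sq (h : MiniBosonSystem f A C (Ioi 0)) {x : ℝ}
    (hx : 0 < x) :
    HasDerivAt (fun y => A y * C y ^ 2)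
      (-(C x ^ 2 / x * (1 - A x
        + x ^ 2 * (A x * deriv f x ^ 2 + (A x * C x ^ 2 - 1) * f x ^ 2)))) x := by
  obtain ⟨-, hA, hC, -, -, hdA, hdC, -, hA', hC'⟩ := h x hx
  refine (hdA.hasDerivAt.mul (hdC.hasDerivAt.pow 2)).congr_deriv ?_
  rw [hA', hC']
  field_simp
  simp
  ring

theorem MiniBosonSystem.hasDerivAt_mul_flux (h : MiniBosonSystem f A C (Ioi 0)) {x : ℝ}
    (hx : 0 < x) :
    HasDerivAt (fun y => f y * (y ^ 2 * deriv f y / C y))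
      (x ^ 2 / C x * deriv f x ^ 2
        + x ^ 2 / (A x * C x) * (1 - A x * C x ^ 2) * f x ^ 2) x := by
  obtain ⟨-, -, hC, hdf, hddf, -, hdC, hflux, -, -⟩ := h x hx
  have hg : DifferentiableAt ℝ (fun y => y ^ 2 * deriv f y / C y) x :=
    ((differentiableAt_id.pow 2).mul hddf).div hdC hC.ne'
  refine (hdf.hasDerivAt.mul hg.hasDerivAt).congr_deriv ?_
  rw [hflux]
  ring

theorem IsAOrbit.system (h : IsAOrbit f A C a α (Ici 0)) : MiniBosonSystem f A C (Ioi 0) := by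
  have := h.2.1
  rwa [Ici_sdiff_left] at this

theorem IsAOrbit.continuousOn_metric (h : IsAOrbit f A C a α (Ici 0)) :
    ContinuousOn A (Ici 0) := by
  intro x hx
  rcases (mem_Ici.1 hx).eq_or_lt with rfl | hx
  · exact h.2.2.2.1
  · obtain ⟨-, -, -, -, -, hdA, -⟩ := h.system x hx
    exact hdA.continuousAt.continuousWithinAt

theorem IsAOrbit.continuousOn_lapse (h : IsAOrbit f A C a α (Ici 0)) :
    ContinuousOn C (Ici 0) := by
  intro x hx
  rcases (mem_Ici.1 hx).eq_or_lt with rfl | hx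
  · exact h.2.2.2.2.1
  · obtain ⟨-, -, -, -, -, -, hdC, -⟩ := h.system x hx
    exact hdC.continuousAt.continuousWithinAt

theorem IsAOrbit.continuousOn_massFn (h : IsAOrbit f A C a α (Ici 0)) :
    ContinuousOn (massFn A) (Ici 0) :=
  (continuousOn_id.mul (continuousOn_const.sub h.continuousOn_metric)).div_const 2

theorem IsAOrbit.massFn_nonneg (h : IsAOrbit f A C a α (Ici 0)) {x : ℝ} (hx : 0 ≤ x) :
    0 ≤ massFn A x := by
  have hmono : MonotoneOn (massFn A) (Ici 0) := by
    refine monotoneOn_of_hasDerivWithinAt_nonneg (convex_Ici 0) h.continuousOn_massFn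
      (fun x hx => (h.system.hasDerivAt_massFn ?_).hasDerivWithinAt) (fun x hx => ?_)
    · simpa using hx
    · have := (h.system x (by simpa using hx)).2.1
      positivity
  simpa [massFn] using hmono self_mem_Ici hx hx

theorem IsAOrbit.metric_le_one (h : IsAOrbit f A C a α (Ici 0)) {x : ℝ} (hx : 0 < x) :
    A x ≤ 1 := by
  have := h.massFn_nonneg hx.le
  rw [massFn] at this
  nlinarith

/-- The bound `A C² ≤ 1` at the centre propagates along the whole orbit. -/
theorem IsAOrbit.mul_sq_le_one (h : IsAOrbit f A C a α (Ici 0)) (hα0 : 0 < α) (hα1 : α ≤ 1)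
    {x : ℝ} (hx : 0 ≤ x) : A x * C x ^ 2 ≤ 1 := by
  obtain ⟨-, -, -, -, -, -, -, hA0, hC0⟩ := id h
  refine le_of_hasDerivAt_nonpos_of_gt (h.continuousOn_metric.mul (h.continuousOn_lapse.pow 2))
    (fun x hx => h.system.hasDerivAt_mul_sq hx) ?_ (fun x hx hgt => ?_) hx
  · change A 0 * C 0 ^ 2 ≤ 1
    rw [hA0, hC0, one_mul]
    exact pow_le_one₀ hα0.le hα1
  · have hA := (h.system x hx).2.1
    have hA1 : 0 ≤ 1 - A x := sub_nonneg.2 (h.metric_le_one hx)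
    have hgt' : 0 ≤ A x * C x ^ 2 - 1 := sub_nonneg.2 hgt.le
    rw [neg_nonpos]
    positivity

/-- If `α ≤ 1` then `f²` never drops below its central value. -/
theorem IsAOrbit.sq_le_sq (h : IsAOrbit f A C a α (Ici 0)) (hα0 : 0 < α) (hα1 : α ≤ 1)
    {x : ℝ} (hx : 0 ≤ x) : a ^ 2 ≤ f x ^ 2 := by
  obtain ⟨-, -, -, -, hC, hf0, hfa, -, hC0⟩ := id h
  have hflux : MonotoneOn (fun y => f y * (y ^ 2 * deriv f y / C y)) (Ioi 0) := by
    refine monotoneOn_of_hasDerivWithinAt_nonneg (convex_Ioi 0)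
      (fun x hx => (h.system.hasDerivAt_mul_flux hx).continuousAt.continuousWithinAt)
      (fun x hx => (h.system.hasDerivAt_mul_flux ?_).hasDerivWithinAt) (fun x hx => ?_)
    · simpa using hx
    · have hx : 0 < x := by simpa using hx
      obtain ⟨-, hAx, hCx, -⟩ := h.system x hx
      have := sub_nonneg.2 (h.mul_sq_le_one hα0 hα1 hx.le)
      positivity
  have hsq : ∀ x, 0 < x → HasDerivAt (fun y => f y ^ 2)
      (2 * (f x * (x ^ 2 * deriv f x / C x)) * C x / x ^ 2) x := by
    intro x hx
    obtain ⟨-, -, hCx, hdf, -⟩ := h.system x hx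
    refine (hdf.hasDerivAt.pow 2).congr_deriv ?_
    field_simp
    simp
    ring
  have hsq0 : HasDerivWithinAt (fun y => f y ^ 2) 0 (Ici 0) 0 := by
    exact (hf0.pow 2).congr_deriv (mul_zero _)
  have hCev : ∀ᶠ x in 𝓝[≥] 0, α / 2 ≤ C x :=
    (hC.eventually_const_lt (by rw [hC0]; linarith)).mono fun _ => le_of_lt
  have hmono : MonotoneOn (fun y => f y ^ 2) (Ici 0) := by
    refine monotoneOn_of_hasDerivWithinAt_nonneg (convex_Ici 0) (fun x hx => ?_)
      (fun x hx => (hsq x ?_).hasDerivWithinAt) (fun x hx => ?_)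
    · rcases (mem_Ici.1 hx).eq_or_lt with rfl | hx
      · exact hsq0.continuousWithinAt
      · exact (hsq x hx).continuousAt.continuousWithinAt
    · simpa using hx
    · have hx : 0 < x := by simpa using hx
      have hCx := (h.system x hx).2.2.1
      have := nonneg_of_monotoneOn_of_hasDerivWithinAt_zero (half_pos hα0) hCev
        (fun s hs t ht hst => mul_le_mul_of_nonneg_left (hflux hs ht hst) zero_le_two) hsq hsq0 hx
      positivity
  simpa [hfa] using hmono self_mem_Ici hx hx

/-- If `α ≤ 1` then the mass function grows at least cubically. -/
theorem IsAOrbit.cube_le_massFn (h : IsAOrbit f A C a α (Ici 0)) (hα0 : 0 < α) (hα1 : α ≤ 1)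
    {x : ℝ} (hx : 0 ≤ x) : a ^ 2 / 6 * x ^ 3 ≤ massFn A x := by
  have hmono : MonotoneOn (fun y => massFn A y - a ^ 2 / 6 * y ^ 3) (Ici 0) := by
    refine monotoneOn_of_hasDerivWithinAt_nonneg (convex_Ici 0)
      (h.continuousOn_massFn.sub (by fun_prop))
      (fun x hx => ((h.system.hasDerivAt_massFn ?_).sub
        ((hasDerivAt_pow 3 x).const_mul _)).hasDerivWithinAt) (fun x hx => ?_)
    · simpa using hx
    · have hx : 0 < x := by simpa using hx
      have hA := (h.system x hx).2.1
      have hfx := h.sq_le_sq hα0 hα1 hx.le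
      have h1 : x ^ 2 / 2 * a ^ 2 ≤
          x ^ 2 / 2 * (A x * deriv f x ^ 2 + A x * C x ^ 2 * f x ^ 2 + f x ^ 2) := by
        gcongr
        have : 0 ≤ A x * deriv f x ^ 2 + A x * C x ^ 2 * f x ^ 2 := by positivity
        linarith
      norm_num
      linarith
  have := hmono self_mem_Ici hx hx
  simpa [massFn] using this

end Orbit

/-- For `0 < α ≤ 1` and `a > 0` there is no globally regular `a`-orbit, i.e.
no `a`-orbit defined on `[0, ∞)` for which the mass function has a finite
limit at infinity. -/
theorem no_global_solutions_alpha_le_one (a α : ℝ)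
    (ha : 0 < a) (hα0 : 0 < α) (hα1 : α ≤ 1) :
    ¬ ∃ f A C : ℝ → ℝ, IsAOrbit f A C a α (Set.Ici 0) ∧
      ∃ Minf : ℝ, Filter.Tendsto (massFn A) Filter.atTop (nhds Minf) := by
  rintro ⟨f, A, C, h, Minf, hM⟩
  have hcube : Tendsto (fun x : ℝ => a ^ 2 / 6 * x ^ 3) atTop atTop :=
    (tendsto_pow_atTop three_ne_zero).const_mul_atTop (by positivity)
  refine not_tendsto_nhds_of_tendsto_atTop (tendsto_atTop_mono' atTop ?_ hcube) Minf hM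
  filter_upwards [eventually_ge_atTop 0] with x hx using h.cube_le_massFn hα0 hα1 hx
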